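/- Fix ρ ∈ (0,1) and ι ∈ (0, 1/2). Let Γ be a Borel probability measure on ℝ^d such that Γ_ρ := ρ·((1−ρ)·Γ) + (1−ρ)·((−ρ)·Γ) is spread out. Then there exist a positive integer d_min, a > 0 and b ∈ ℝ such that for every integer m ≥ d_min there is δ_m > 0 with the following property: for every measurable allocation function g: ℝ^d × ℝ^d → [ι, 1−ι], the m-step transition kernel satisfies P_g^m(Λ, A) ≥ δ_m · Leb(A ∩ B(Λ, a·m + b)) for every Λ ∈ ℝ^d and every Borel set A, where B(Λ, r) is the Euclidean ball of radius r centered at Λ. Consequently, the linear span of the topological support of Γ equals all of ℝ^d. -/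

import Mathlib

open MeasureTheory ProbabilityTheory Filter Set
open scoped ENNReal RealInnerProductSpace

noncomputable section

/-- `ℝ^d` with the Euclidean norm. -/
abbrev Ed (d : ℕ) : Type := EuclideanSpace ℝ (Fin d)

/-- Action of the CAR transition kernel `P_g` on a function `h`:
`(P_g h)(Λ) = ∫ [ g(Λ,X)·h(Λ + (1−ρ)X) + (1−g(Λ,X))·h(Λ − ρX) ] dΓ(X)`. -/
def kernelOp (d : ℕ) (ρ : ℝ) (Γ : Measure (Ed d)) (g : Ed d → Ed d → ℝ)
    (h : Ed d → ℝ) (Λ : Ed d) : ℝ :=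
  ∫ X, g Λ X * h (Λ + (1 - ρ) • X) + (1 - g Λ X) * h (Λ - ρ • X) ∂Γ

/-- `W_Γ`: the linear span of the topological support of `Γ` (the set of points all of
whose open neighbourhoods have positive measure). -/
def suppSpan (d : ℕ) (Γ : Measure (Ed d)) : Submodule ℝ (Ed d) :=
  Submodule.span ℝ {x : Ed d | ∀ U : Set (Ed d), IsOpen U → x ∈ U → 0 < Γ U}

/-- The `(M,Δ)`-negative feedback condition for an allocation function `g`. -/
def NegFeedback (d : ℕ) (ρ M Δ : ℝ) (Γ : Measure (Ed d)) (g : Ed d → Ed d → ℝ) : Prop :=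
  ∀ Λ : Ed d, Λ ∈ suppSpan d Γ → M ≤ ‖Λ‖ →
    (∫ X, (g Λ X - ρ) * (⟪X, Λ⟫ / ‖Λ‖) ∂Γ) ≤ -Δ

/-- `Γ` is sub-exponential: `∫ exp(λ‖X‖) dΓ(X) < ∞` for some `λ > 0`. -/
def SubExp (d : ℕ) (Γ : Measure (Ed d)) : Prop :=
  ∃ l : ℝ, 0 < l ∧ Integrable (fun x => Real.exp (l * ‖x‖)) Γ

/-- `k`-fold convolution power of a measure (`convPow μ 0` is the Dirac mass at `0`). -/
def convPow (d : ℕ) (μ : Measure (Ed d)) : ℕ → Measure (Ed d)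
  | 0 => Measure.dirac 0
  | n + 1 => ((convPow d μ n).prod μ).map (fun p => p.1 + p.2)

/-- A measure is spread out if some convolution power dominates `f·Leb` for a nonnegative
measurable `f` with `∫ f dLeb > 0`. -/
def SpreadOut (d : ℕ) (μ : Measure (Ed d)) : Prop :=
  ∃ k : ℕ, 0 < k ∧ ∃ f : Ed d → ℝ, Measurable f ∧ (∀ x, 0 ≤ f x) ∧
    (0 < ∫ x, f x) ∧
    ∀ A : Set (Ed d), MeasurableSet A →
      ENNReal.ofReal (∫ x in A, f x) ≤ convPow d μ k A

/-- `Γ_ρ`: the mixture `ρ·((1−ρ)·Γ) + (1−ρ)·((−ρ)·Γ)` of the pushforwards of `Γ` under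
scalar multiplication by `1−ρ` and by `−ρ`. -/
def mixMeasure (d : ℕ) (ρ : ℝ) (Γ : Measure (Ed d)) : Measure (Ed d) :=
  ENNReal.ofReal ρ • Γ.map (fun x => (1 - ρ) • x) +
    ENNReal.ofReal (1 - ρ) • Γ.map (fun x => (-ρ) • x)

section Minorization

open scoped Topology NNReal symmDiff

variable {d : ℕ} {μ ν : Measure (Ed d)} {S T : Set (Ed d)}

/-- `μ` dominates a positive multiple of Lebesgue measure on `S`. -/
def MinorizedOn (μ : Measure (Ed d)) (S : Set (Ed d)) : Prop :=
  ∃ η : ℝ≥0, 0 < η ∧ ∀ A : Set (Ed d), MeasurableSet A → η * volume (A ∩ S) ≤ μ A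

/-- The points near which `μ` dominates a positive multiple of Lebesgue measure. -/
def minorizedCore (μ : Measure (Ed d)) : Set (Ed d) :=
  {z | ∃ S ∈ 𝓝 z, MinorizedOn μ S}

lemma MinorizedOn.mono (h : MinorizedOn μ T) (hST : S ⊆ T) : MinorizedOn μ S := by
  obtain ⟨η, hη, h⟩ := h
  exact ⟨η, hη, fun A hA => le_trans (by gcongr) (h A hA)⟩

lemma MinorizedOn.union (hS : MinorizedOn μ S) (hT : MinorizedOn μ T) :
    MinorizedOn μ (S ∪ T) := by
  obtain ⟨η, hη, hS⟩ := hS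
  obtain ⟨θ, hθ, hT⟩ := hT
  refine ⟨min η θ / 2, by positivity, fun A hA => ?_⟩
  have h2 : ((min η θ / 2 : ℝ≥0) : ℝ≥0∞) = (min η θ : ℝ≥0) / 2 := by
    rw [ENNReal.coe_div two_ne_zero]; rfl
  have h1 : ((min η θ : ℝ≥0) : ℝ≥0∞) * volume (A ∩ (S ∪ T)) ≤ μ A + μ A := by
    calc ((min η θ : ℝ≥0) : ℝ≥0∞) * volume (A ∩ (S ∪ T))
        ≤ (min η θ : ℝ≥0) * (volume (A ∩ S) + volume (A ∩ T)) := by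
          rw [inter_union_distrib_left]
          gcongr
          exact measure_union_le _ _
      _ ≤ η * volume (A ∩ S) + θ * volume (A ∩ T) := by
          rw [mul_add]
          gcongr
          · exact min_le_left _ _
          · exact min_le_right _ _
      _ ≤ μ A + μ A := add_le_add (hS A hA) (hT A hA)
  rw [h2, ENNReal.mul_comm_div, ← mul_div_assoc]
  refine ENNReal.div_le_of_le_mul ?_
  rwa [mul_two]

lemma minorizedOn_empty : MinorizedOn μ ∅ := ⟨1, one_pos, by simp⟩

lemma isOpen_minorizedCore : IsOpen (minorizedCore μ) := by
  rw [isOpen_iff_mem_nhds]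
  rintro z ⟨S, hS, h⟩
  filter_upwards [eventually_mem_nhds_iff.mpr hS] with w hw using ⟨S, hw, h⟩

lemma minorizedOn_of_isCompact (hS : IsCompact S) (h : S ⊆ minorizedCore μ) :
    MinorizedOn μ S := by
  refine hS.induction_on minorizedOn_empty (fun s t hst ht => ht.mono hst)
    (fun s t => MinorizedOn.union) fun x hx => ?_
  obtain ⟨T, hT, h⟩ := h hx
  exact ⟨T, mem_nhdsWithin_of_mem_nhds hT, h⟩

lemma minorizedCore_subset_support : minorizedCore μ ⊆ μ.support := by
  rintro z ⟨S, hS, η, hη, h⟩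
  rw [Measure.mem_support_iff_forall]
  intro U hU
  obtain ⟨V, hVU, hV, hzV⟩ := mem_nhds_iff.mp hU
  refine lt_of_lt_of_le ?_ ((h V hV.measurableSet).trans (measure_mono hVU))
  refine ENNReal.mul_pos (by simpa using hη.ne') ?_
  exact (Measure.measure_pos_of_mem_nhds _ (inter_mem (hV.mem_nhds hzV) hS)).ne'

lemma conv_apply_eq_lintegral [IsProbabilityMeasure μ] [IsProbabilityMeasure ν]
    {A : Set (Ed d)} (hA : MeasurableSet A) :
    (μ ∗ ν) A = ∫⁻ w, μ ((fun u => u + w) ⁻¹' A) ∂ν := by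
  have hmeas : Measurable fun p : Ed d × Ed d => p.1 + p.2 := by fun_prop
  rw [Measure.conv, Measure.map_apply hmeas hA, Measure.prod_apply_symm (hmeas hA)]
  rfl

lemma add_mem_support_conv [IsProbabilityMeasure μ] [IsProbabilityMeasure ν] {y z : Ed d}
    (hz : z ∈ μ.support) (hy : y ∈ ν.support) : z + y ∈ (μ ∗ ν).support := by
  rw [Measure.mem_support_iff_forall] at *
  intro U hU
  have hmeas : Measurable fun p : Ed d × Ed d => p.1 + p.2 := by fun_prop
  have hU' : (fun p : Ed d × Ed d => p.1 + p.2) ⁻¹' U ∈ 𝓝 (z, y) :=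
    (by fun_prop : Continuous fun p : Ed d × Ed d => p.1 + p.2).continuousAt hU
  obtain ⟨V, hV, W, hW, hVW⟩ := mem_nhds_prod_iff.mp hU'
  calc 0 < μ V * ν W := ENNReal.mul_pos (hz V hV).ne' (hy W hW).ne'
    _ = μ.prod ν (V ×ˢ W) := (Measure.prod_prod V W).symm
    _ ≤ μ.prod ν ((fun p : Ed d × Ed d => p.1 + p.2) ⁻¹' U) := measure_mono hVW
    _ ≤ (μ ∗ ν) U := Measure.le_map_apply hmeas.aemeasurable U

lemma exists_add_mem_of_mem_support_conv [IsProbabilityMeasure μ] [IsProbabilityMeasure ν]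
    {z : Ed d} (hz : z ∈ (μ ∗ ν).support) {ε : ℝ} (hε : 0 < ε) :
    ∃ x ∈ μ.support, ∃ y ∈ ν.support, ‖z - (x + y)‖ < ε := by
  have hmeas : Measurable fun p : Ed d × Ed d => p.1 + p.2 := by fun_prop
  have h := (Measure.mem_support_iff_forall z).mp hz _ (Metric.ball_mem_nhds z hε)
  rw [Measure.conv, Measure.map_apply hmeas Metric.isOpen_ball.measurableSet] at h
  have hμ : ∀ᵐ p ∂μ.prod ν, p.1 ∈ μ.support :=
    Measure.quasiMeasurePreserving_fst.ae Measure.support_mem_ae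
  have hν : ∀ᵐ p ∂μ.prod ν, p.2 ∈ ν.support :=
    Measure.quasiMeasurePreserving_snd.ae Measure.support_mem_ae
  have hball : ∃ᵐ p ∂μ.prod ν, p.1 + p.2 ∈ Metric.ball z ε :=
    frequently_ae_iff.mpr h.ne'
  obtain ⟨p, hp, hpμ, hpν⟩ := (hball.and_eventually (hμ.and hν)).exists
  refine ⟨p.1, hpμ, p.2, hpν, ?_⟩
  rwa [mem_ball_iff_norm'] at hp

lemma add_mem_minorizedCore_conv [IsProbabilityMeasure μ] [IsProbabilityMeasure ν]
    {y z : Ed d} (hz : z ∈ minorizedCore μ) (hy : y ∈ ν.support) :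
    z + y ∈ minorizedCore (μ ∗ ν) := by
  obtain ⟨S, hS, η, hη, h⟩ := hz
  obtain ⟨s, hs, hsS⟩ := Metric.mem_nhds_iff.mp hS
  have hV := (Measure.mem_support_iff_forall y).mp hy _ (Metric.ball_mem_nhds y (half_pos hs))
  set V := Metric.ball y (s / 2)
  refine ⟨Metric.ball (z + y) (s / 2), Metric.ball_mem_nhds _ (half_pos hs),
    η * (ν V).toNNReal, mul_pos hη (ENNReal.toNNReal_pos hV.ne' (measure_ne_top _ _)),
    fun A hA => ?_⟩
  rw [conv_apply_eq_lintegral hA, ENNReal.coe_mul, ENNReal.coe_toNNReal (measure_ne_top _ _)]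
  calc (η : ℝ≥0∞) * ν V * volume (A ∩ Metric.ball (z + y) (s / 2))
      = ∫⁻ _ in V, η * volume (A ∩ Metric.ball (z + y) (s / 2)) ∂ν := by
        rw [setLIntegral_const]; ring
    _ ≤ ∫⁻ w in V, μ ((fun u => u + w) ⁻¹' A) ∂ν := by
        refine setLIntegral_mono' Metric.isOpen_ball.measurableSet fun w hw => ?_
        refine le_trans ?_ (h _ (measurable_add_const w hA))
        rw [← measure_preimage_add_right volume w]
        gcongr
        rintro u ⟨huA, hu⟩
        refine ⟨huA, hsS ?_⟩
        rw [mem_ball_iff_norm] at *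
        calc ‖u - z‖ = ‖(u + w - (z + y)) - (w - y)‖ := by congr 1; abel
          _ ≤ ‖u + w - (z + y)‖ + ‖w - y‖ := norm_sub_le _ _
          _ < s := by linarith
    _ ≤ ∫⁻ w, μ ((fun u => u + w) ⁻¹' A) ∂ν := setLIntegral_le_lintegral _ _

lemma eventually_le_measure_inter_preimage_sub {B : Set (Ed d)} (hB : MeasurableSet B)
    (hfin : volume B ≠ ∞) (z₀ : Ed d) {c : ℝ≥0∞}
    (hc : c < volume (B ∩ (fun w => z₀ - w) ⁻¹' B)) :
    ∀ᶠ z in 𝓝 z₀, c ≤ volume (B ∩ (fun w => z - w) ⁻¹' B) := by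
  let F : C(Ed d, C(Ed d, Ed d)) :=
    ContinuousMap.curry ⟨fun p : Ed d × Ed d => p.1 - p.2, by fun_prop⟩
  have hF : ∀ z, MeasurePreserving (F z) volume volume := fun z =>
    Measure.measurePreserving_sub_left volume z
  have ht := tendsto_measure_symmDiff_preimage_nhds_zero (F.continuous.tendsto z₀)
    (.of_forall hF) (hF z₀) hB.nullMeasurableSet hfin
  have hpos : 0 < volume (B ∩ (fun w => z₀ - w) ⁻¹' B) - c := tsub_pos_of_lt hc
  filter_upwards [ht.eventually (gt_mem_nhds hpos)] with z hz
  have hle : volume (B ∩ (fun w => z₀ - w) ⁻¹' B) ≤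
      volume (B ∩ (fun w => z - w) ⁻¹' B) + volume ((F z ⁻¹' B) ∆ (F z₀ ⁻¹' B)) := by
    refine (measure_mono ?_).trans (measure_union_le _ _)
    rintro w ⟨hwB, hw⟩
    by_cases hwz : z - w ∈ B
    · exact Or.inl ⟨hwB, hwz⟩
    · exact Or.inr (Or.inr ⟨hw, hwz⟩)
  by_contra! hlt
  have h1 : volume (B ∩ (fun w => z₀ - w) ⁻¹' B) < c + (volume (B ∩ (fun w => z₀ - w) ⁻¹' B) - c) :=
    hle.trans_lt (ENNReal.add_lt_add hlt hz)
  rw [add_tsub_cancel_of_le hc.le] at h1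
  exact lt_irrefl _ h1

lemma minorizedCore_conv_self_nonempty [IsProbabilityMeasure μ] {B : Set (Ed d)}
    (hB : MeasurableSet B) (hpos : volume B ≠ 0) (hfin : volume B ≠ ∞)
    (h : MinorizedOn μ B) : (minorizedCore (μ ∗ μ)).Nonempty := by
  obtain ⟨η, hη, h⟩ := h
  have hmeas : MeasurableSet {p : Ed d × Ed d | p.2 - p.1 ∈ B} :=
    (by fun_prop : Measurable fun p : Ed d × Ed d => p.2 - p.1) hB
  have hswap : ∀ A : Set (Ed d), MeasurableSet A →
      ∫⁻ w in B, volume ((fun u => u + w) ⁻¹' A ∩ B) =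
        ∫⁻ z in A, volume (B ∩ (fun w => z - w) ⁻¹' B) := by
    intro A hA
    calc ∫⁻ w in B, volume ((fun u => u + w) ⁻¹' A ∩ B)
        = ∫⁻ w in B, ∫⁻ z in A, {p : Ed d × Ed d | p.2 - p.1 ∈ B}.indicator 1 (w, z) := by
          refine lintegral_congr fun w => ?_
          have hw : MeasurableSet {z : Ed d | z - w ∈ B} := measurable_sub_const w hB
          change _ = ∫⁻ z in A, {z : Ed d | z - w ∈ B}.indicator 1 z
          rw [lintegral_indicator_one hw, Measure.restrict_apply hw,
            ← measure_preimage_add_right volume w ({z : Ed d | z - w ∈ B} ∩ A)]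
          congr 1
          ext u
          simp [and_comm]
      _ = ∫⁻ z in A, ∫⁻ w in B, {p : Ed d × Ed d | p.2 - p.1 ∈ B}.indicator 1 (w, z) :=
          lintegral_lintegral_swap (by
            exact (measurable_one.indicator hmeas).aemeasurable)
      _ = ∫⁻ z in A, volume (B ∩ (fun w => z - w) ⁻¹' B) := by
          refine lintegral_congr fun z => ?_
          have hz : MeasurableSet {w : Ed d | z - w ∈ B} := measurable_const_sub z hB
          change ∫⁻ w in B, {w : Ed d | z - w ∈ B}.indicator 1 w = _
          rw [lintegral_indicator_one hz, Measure.restrict_apply hz, inter_comm]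
          rfl
  obtain ⟨z₀, hz₀⟩ : ∃ z₀, volume (B ∩ (fun w => z₀ - w) ⁻¹' B) ≠ 0 := by
    by_contra! h0
    have h1 := hswap univ .univ
    simp only [preimage_univ, univ_inter, h0, lintegral_const, Measure.restrict_apply,
      MeasurableSet.univ, zero_mul, mul_eq_zero, or_self] at h1
    exact hpos h1
  obtain ⟨c, hc0, hc⟩ := exists_between (pos_iff_ne_zero.mpr hz₀)
  obtain ⟨r, hr, hN⟩ :=
    Metric.mem_nhds_iff.mp (eventually_le_measure_inter_preimage_sub hB hfin z₀ hc)
  set N := Metric.ball z₀ r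
  refine ⟨z₀, N, Metric.ball_mem_nhds z₀ hr, η * η * c.toNNReal,
    mul_pos (mul_pos hη hη) (ENNReal.toNNReal_pos hc0.ne' hc.ne_top), fun A hA => ?_⟩
  have hμ : (η : ℝ≥0∞) • volume.restrict B ≤ μ :=
    Measure.le_iff.mpr fun A hA => by simpa [Measure.restrict_apply hA] using h A hA
  rw [conv_apply_eq_lintegral hA, ENNReal.coe_mul, ENNReal.coe_mul,
    ENNReal.coe_toNNReal hc.ne_top]
  calc (η : ℝ≥0∞) * η * c * volume (A ∩ N)
      ≤ η * (η * ∫⁻ z in A, volume (B ∩ (fun w => z - w) ⁻¹' B)) := by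
        rw [mul_assoc, mul_assoc]
        gcongr
        calc c * volume (A ∩ N) = ∫⁻ _ in A ∩ N, c := (setLIntegral_const _ _).symm
          _ ≤ ∫⁻ z in A ∩ N, volume (B ∩ (fun w => z - w) ⁻¹' B) :=
              setLIntegral_mono' (hA.inter Metric.isOpen_ball.measurableSet)
                fun z hz => hN hz.2
          _ ≤ _ := lintegral_mono_set inter_subset_left
    _ = η * ∫⁻ w in B, η * volume ((fun u => u + w) ⁻¹' A ∩ B) := by
        rw [← hswap A hA, lintegral_const_mul' _ _ ENNReal.coe_ne_top]
    _ ≤ η * ∫⁻ w in B, μ ((fun u => u + w) ⁻¹' A) := by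
        gcongr with w
        exact h _ (measurable_add_const w hA)
    _ = ∫⁻ w, μ ((fun u => u + w) ⁻¹' A) ∂((η : ℝ≥0∞) • volume.restrict B) := by
        rw [lintegral_smul_measure, smul_eq_mul]
    _ ≤ ∫⁻ w, μ ((fun u => u + w) ⁻¹' A) ∂μ := lintegral_mono' hμ le_rfl

end Minorization

section Convolution

open scoped Topology NNReal

variable {d : ℕ} {μ Γ : Measure (Ed d)} {ρ : ℝ}

lemma convPow_succ (n : ℕ) : convPow d μ (n + 1) = convPow d μ n ∗ μ := rfl

instance isProbabilityMeasure_convPow [IsProbabilityMeasure μ] (n : ℕ) :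
    IsProbabilityMeasure (convPow d μ n) := by
  induction n with
  | zero => exact inferInstanceAs (IsProbabilityMeasure (Measure.dirac 0))
  | succ n ih => rw [convPow_succ]; infer_instance

lemma convPow_add [IsProbabilityMeasure μ] (n m : ℕ) :
    convPow d μ (n + m) = convPow d μ n ∗ convPow d μ m := by
  induction m with
  | zero => exact (Measure.conv_dirac_zero _).symm
  | succ m ih => rw [← add_assoc, convPow_succ, ih, convPow_succ, Measure.conv_assoc]

lemma SpreadOut.exists_nonempty_minorizedCore [IsProbabilityMeasure μ] (h : SpreadOut d μ) :
    ∃ n, 0 < n ∧ (minorizedCore (convPow d μ n)).Nonempty := by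
  obtain ⟨k, hk, f, hf, hf0, hfpos, hle⟩ := h
  have hint : Integrable f := by
    by_contra hint
    exact hfpos.ne' (integral_undef hint)
  have hne : volume {x | 0 < f x} ≠ 0 := by
    intro h0
    refine hfpos.ne' (integral_eq_zero_of_ae ?_)
    filter_upwards [measure_eq_zero_iff_ae_notMem.mp h0] with x hx
    exact le_antisymm (not_lt.mp hx) (hf0 x)
  obtain ⟨ε, hε, hεpos⟩ : ∃ ε : ℝ, 0 < ε ∧ volume {x | ε ≤ f x} ≠ 0 := by
    by_contra! hall
    refine hne (measure_mono_null (fun x hx => ?_)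
      (measure_iUnion_null fun n : ℕ => hall (1 / ((n : ℝ) + 1)) (by positivity)))
    obtain ⟨n, hn⟩ := exists_nat_one_div_lt (show 0 < f x from hx)
    exact mem_iUnion.mpr ⟨n, hn.le⟩
  refine ⟨k + k, by omega, ?_⟩
  rw [convPow_add]
  have hB : MeasurableSet {x | ε ≤ f x} := measurableSet_le measurable_const hf
  refine minorizedCore_conv_self_nonempty hB hεpos
    (hint.measure_ge_lt_top hε).ne ⟨ε.toNNReal, Real.toNNReal_pos.mpr hε, fun A hA => ?_⟩
  refine le_trans ?_ (hle A hA)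
  rw [ofReal_integral_eq_lintegral_ofReal hint.integrableOn (ae_of_all _ hf0)]
  calc (ε.toNNReal : ℝ≥0∞) * volume (A ∩ {x | ε ≤ f x})
      = ∫⁻ _ in A ∩ {x | ε ≤ f x}, ENNReal.ofReal ε := (setLIntegral_const _ _).symm
    _ ≤ ∫⁻ x in A ∩ {x | ε ≤ f x}, ENNReal.ofReal (f x) :=
        setLIntegral_mono' (hA.inter hB) fun x hx => ENNReal.ofReal_le_ofReal hx.2
    _ ≤ ∫⁻ x in A, ENNReal.ofReal (f x) := lintegral_mono_set inter_subset_left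

lemma support_smul_measure {c : ℝ≥0∞} (hc : c ≠ 0) : (c • μ).support = μ.support := by
  ext x
  simp [Measure.mem_support_iff_forall, pos_iff_ne_zero, hc]

lemma mem_support_map_smul_iff {c : ℝ} (hc : c ≠ 0) {z : Ed d} :
    z ∈ (μ.map (fun x => c • x)).support ↔ ∃ x ∈ μ.support, c • x = z := by
  have hmap := (measurableEmbedding_const_smul₀ (α := Ed d) hc).map_apply μ
  constructor
  · intro hz
    refine ⟨c⁻¹ • z, (Measure.mem_support_iff_forall _).mpr fun U hU => ?_, smul_inv_smul₀ hc z⟩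
    have hV : (fun w : Ed d => c⁻¹ • w) ⁻¹' U ∈ 𝓝 z :=
      (continuous_const_smul c⁻¹).continuousAt hU
    have h := (Measure.mem_support_iff_forall z).mp hz _ hV
    rw [hmap] at h
    simpa [preimage_preimage, smul_smul, hc] using h
  · rintro ⟨x, hx, rfl⟩
    rw [Measure.mem_support_iff_forall] at *
    intro U hU
    rw [hmap]
    exact hx _ ((continuous_const_smul c).continuousAt hU)

lemma mem_support_mixMeasure_iff (hρ : ρ ∈ Ioo (0 : ℝ) 1) {z : Ed d} :
    z ∈ (mixMeasure d ρ Γ).support ↔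
      ∃ x ∈ Γ.support, (1 - ρ) • x = z ∨ (-ρ) • x = z := by
  have h1 : 0 < 1 - ρ := sub_pos.mpr hρ.2
  rw [mixMeasure, Measure.support_add,
    support_smul_measure (ENNReal.ofReal_pos.mpr hρ.1).ne',
    support_smul_measure (ENNReal.ofReal_pos.mpr h1).ne', mem_union,
    mem_support_map_smul_iff h1.ne', mem_support_map_smul_iff (neg_ne_zero.mpr hρ.1.ne')]
  simp only [and_or_left, exists_or]

lemma isProbabilityMeasure_mixMeasure [IsProbabilityMeasure Γ] (hρ : ρ ∈ Ioo (0 : ℝ) 1) :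
    IsProbabilityMeasure (mixMeasure d ρ Γ) := by
  constructor
  have h1 : AEMeasurable (fun x : Ed d => (1 - ρ) • x) Γ := by fun_prop
  have h2 : AEMeasurable (fun x : Ed d => (-ρ) • x) Γ := by fun_prop
  rw [mixMeasure, Measure.add_apply, Measure.smul_apply, Measure.smul_apply,
    Measure.map_apply_of_aemeasurable h1 .univ, Measure.map_apply_of_aemeasurable h2 .univ,
    preimage_univ, preimage_univ, measure_univ, smul_eq_mul, smul_eq_mul, mul_one, mul_one,
    ← ENNReal.ofReal_add hρ.1.le (sub_nonneg.mpr hρ.2.le)]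
  simp

lemma add_mem_support_convPow [IsProbabilityMeasure μ] {n m : ℕ} {x y : Ed d}
    (hx : x ∈ (convPow d μ n).support) (hy : y ∈ (convPow d μ m).support) :
    x + y ∈ (convPow d μ (n + m)).support := by
  rw [convPow_add]
  exact add_mem_support_conv hx hy

lemma zero_mem_support_convPow_zero : (0 : Ed d) ∈ (convPow d μ 0).support := by
  rw [Measure.mem_support_iff_forall]
  intro U hU
  change 0 < Measure.dirac (0 : Ed d) U
  rw [Measure.dirac_apply_of_mem (mem_of_mem_nhds hU)]
  exact one_pos

lemma eq_zero_of_mem_support_convPow_zero {z : Ed d} (hz : z ∈ (convPow d μ 0).support) :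
    z = 0 := by
  have h : ({0} : Set (Ed d)) ∈ ae (convPow d μ 0) := by
    change ∀ᵐ x ∂(Measure.dirac (0 : Ed d)), x = 0
    simp
  exact Measure.support_subset_of_isClosed isClosed_singleton h hz

lemma nsmul_mem_support_convPow [IsProbabilityMeasure μ] {x : Ed d} (hx : x ∈ μ.support)
    (n : ℕ) : (n : ℝ) • x ∈ (convPow d μ n).support := by
  induction n with
  | zero => simpa using zero_mem_support_convPow_zero
  | succ n ih =>
    rw [convPow_succ, Nat.cast_succ, add_smul, one_smul]
    exact add_mem_support_conv ih hx

lemma exists_nat_abs_sub_mul_lt (hρ : ρ ∈ Ioo (0 : ℝ) 1) {ε : ℝ} (hε : 0 < ε) :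
    ∃ p q : ℕ, |((p : ℝ) + 1) * (1 - ρ) - ((q : ℝ) + 1) * ρ| < ε := by
  have hδ : 0 < min ε (min ρ (1 - ρ)) := lt_min hε (lt_min hρ.1 (sub_pos.mpr hρ.2))
  obtain ⟨n, hn⟩ := exists_nat_one_div_lt hδ
  obtain ⟨j, k, hk, -, hjk⟩ := Real.exists_int_int_abs_mul_sub_le ρ n.succ_pos
  have hlt : |(k : ℝ) * ρ - j| < min ε (min ρ (1 - ρ)) := by
    refine (hjk.trans ?_).trans_lt hn
    push_cast
    gcongr
    linarith
  obtain ⟨h1, h2⟩ := lt_min_iff.mp hlt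
  obtain ⟨h2, h3⟩ := lt_min_iff.mp h2
  rw [abs_lt] at h2 h3
  have hk1 : (1 : ℝ) ≤ k := by exact_mod_cast hk
  have hj : 0 < j := by
    by_contra! hj
    have hj' : (j : ℝ) ≤ 0 := by exact_mod_cast hj
    nlinarith [hρ.1, mul_le_mul_of_nonneg_right hk1 hρ.1.le]
  have hjk' : 0 < k - j := by
    by_contra! hj
    have hj' : (k : ℝ) - j ≤ 0 := by exact_mod_cast hj
    nlinarith [hρ.2, mul_le_mul_of_nonneg_right hk1 (sub_pos.mpr hρ.2).le]
  obtain ⟨p, hp⟩ := Int.eq_succ_of_zero_lt hj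
  obtain ⟨q, hq⟩ := Int.eq_succ_of_zero_lt hjk'
  have hp' : (j : ℝ) = p + 1 := by rw [hp]; push_cast; rfl
  have hq' : (k : ℝ) - j = q + 1 := by
    have h : (k : ℝ) - j = ((k - j : ℤ) : ℝ) := by push_cast; rfl
    rw [h, hq]
    push_cast
    rfl
  refine ⟨p, q, ?_⟩
  rw [← hp', ← hq', show (j : ℝ) * (1 - ρ) - (k - j) * ρ = -(k * ρ - j) by ring, abs_neg]
  exact h1

lemma exists_return_of_mem_support_mixMeasure [IsProbabilityMeasure Γ]
    (hρ : ρ ∈ Ioo (0 : ℝ) 1) {z : Ed d} (hz : z ∈ (mixMeasure d ρ Γ).support) {ε : ℝ}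
    (hε : 0 < ε) :
    ∃ m, ∃ y ∈ (convPow d (mixMeasure d ρ Γ) m).support, ‖z + y‖ < ε := by
  have := isProbabilityMeasure_mixMeasure (Γ := Γ) hρ
  obtain ⟨x, hx, hzx⟩ := (mem_support_mixMeasure_iff hρ).mp hz
  obtain ⟨p, q, hpq⟩ := exists_nat_abs_sub_mul_lt hρ (div_pos hε (by positivity : 0 < ‖x‖ + 1))
  have hu : (1 - ρ) • x ∈ (mixMeasure d ρ Γ).support :=
    (mem_support_mixMeasure_iff hρ).mpr ⟨x, hx, .inl rfl⟩
  have hv : (-ρ) • x ∈ (mixMeasure d ρ Γ).support :=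
    (mem_support_mixMeasure_iff hρ).mpr ⟨x, hx, .inr rfl⟩
  have hsmall : ‖(((p : ℝ) + 1) * (1 - ρ) - ((q : ℝ) + 1) * ρ) • x‖ < ε := by
    rw [norm_smul, Real.norm_eq_abs]
    rw [lt_div_iff₀ (by positivity)] at hpq
    refine lt_of_le_of_lt ?_ hpq
    gcongr
    linarith
  rcases hzx with rfl | rfl
  · refine ⟨p + (q + 1), _, add_mem_support_convPow (nsmul_mem_support_convPow hu p)
      (nsmul_mem_support_convPow hv (q + 1)), ?_⟩
    convert hsmall using 2
    push_cast
    module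
  · refine ⟨(p + 1) + q, _, add_mem_support_convPow (nsmul_mem_support_convPow hu (p + 1))
      (nsmul_mem_support_convPow hv q), ?_⟩
    convert hsmall using 2
    push_cast
    module

lemma exists_return_of_mem_support_convPow [IsProbabilityMeasure Γ]
    (hρ : ρ ∈ Ioo (0 : ℝ) 1) (n : ℕ) :
    ∀ z ∈ (convPow d (mixMeasure d ρ Γ) n).support, ∀ ε > 0,
      ∃ m, ∃ y ∈ (convPow d (mixMeasure d ρ Γ) m).support, ‖z + y‖ < ε := by
  have := isProbabilityMeasure_mixMeasure (Γ := Γ) hρ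
  induction n with
  | zero =>
    intro z hz ε hε
    refine ⟨0, 0, zero_mem_support_convPow_zero, ?_⟩
    rwa [eq_zero_of_mem_support_convPow_zero hz, add_zero, norm_zero]
  | succ n ih =>
    intro z hz ε hε
    rw [convPow_succ] at hz
    obtain ⟨u, hu, v, hv, huv⟩ :=
      exists_add_mem_of_mem_support_conv hz (by positivity : 0 < ε / 3)
    obtain ⟨m, y, hy, hy'⟩ := ih u hu (ε / 3) (by positivity)
    obtain ⟨l, w, hw, hw'⟩ :=
      exists_return_of_mem_support_mixMeasure hρ hv (by positivity : 0 < ε / 3)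
    refine ⟨m + l, y + w, add_mem_support_convPow hy hw, ?_⟩
    calc ‖z + (y + w)‖ = ‖(z - (u + v)) + (u + y) + (v + w)‖ := by congr 1; abel
      _ ≤ ‖z - (u + v)‖ + ‖u + y‖ + ‖v + w‖ := norm_add₃_le
      _ < ε := by linarith

lemma exists_zero_mem_minorizedCore [IsProbabilityMeasure Γ] (hρ : ρ ∈ Ioo (0 : ℝ) 1)
    (h : SpreadOut d (mixMeasure d ρ Γ)) :
    ∃ n, 0 < n ∧ (0 : Ed d) ∈ minorizedCore (convPow d (mixMeasure d ρ Γ) n) := by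
  have := isProbabilityMeasure_mixMeasure (Γ := Γ) hρ
  obtain ⟨n, hn, z, hz⟩ := h.exists_nonempty_minorizedCore
  obtain ⟨ε, hε, hball⟩ := Metric.isOpen_iff.mp isOpen_minorizedCore z hz
  obtain ⟨m, y, hy, hy'⟩ :=
    exists_return_of_mem_support_convPow hρ n z (minorizedCore_subset_support hz) ε hε
  have hmem : -y ∈ minorizedCore (convPow d (mixMeasure d ρ Γ) n) := by
    refine hball ?_
    rwa [mem_ball_iff_norm', sub_neg_eq_add]
  refine ⟨n + m, by omega, ?_⟩
  rw [convPow_add, ← neg_add_cancel y]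
  exact add_mem_minorizedCore_conv hmem hy

lemma ball_subset_minorizedCore_convPow_mul [IsProbabilityMeasure μ] {n : ℕ} {r : ℝ}
    (h : Metric.ball 0 r ⊆ minorizedCore (convPow d μ n)) (j : ℕ) :
    Metric.ball 0 (((j + 1 : ℕ) : ℝ) * r) ⊆ minorizedCore (convPow d μ (n * (j + 1))) := by
  induction j with
  | zero => simpa using h
  | succ j ih =>
    intro w hw
    rw [mem_ball_zero_iff] at hw
    push_cast at hw
    have hj : (0 : ℝ) < j + 1 + 1 := by positivity
    have hw1 : (((j : ℝ) + 1) / (j + 1 + 1)) • w ∈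
        minorizedCore (convPow d μ (n * (j + 1))) := by
      refine ih ?_
      rw [mem_ball_zero_iff, norm_smul, Real.norm_of_nonneg (by positivity), div_mul_eq_mul_div,
        div_lt_iff₀ hj]
      push_cast
      nlinarith
    have hw2 : ((1 : ℝ) / (j + 1 + 1)) • w ∈ (convPow d μ n).support := by
      refine minorizedCore_subset_support (h ?_)
      rw [mem_ball_zero_iff, norm_smul, Real.norm_of_nonneg (by positivity), div_mul_eq_mul_div,
        div_lt_iff₀ hj]
      linarith
    have hadd := add_mem_minorizedCore_conv hw1 hw2
    rw [← convPow_add, ← add_smul, ← add_div, div_self hj.ne', one_smul] at hadd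
    exact hadd

lemma exists_closedBall_subset_minorizedCore_convPow [IsProbabilityMeasure μ] {n : ℕ}
    (hn : 0 < n) (h : (0 : Ed d) ∈ minorizedCore (convPow d μ n)) :
    ∃ a > (0 : ℝ), ∃ b : ℝ, ∀ m : ℕ,
      Metric.closedBall 0 (a * m + b) ⊆ minorizedCore (convPow d μ m) := by
  obtain ⟨r, hr, hball⟩ := Metric.isOpen_iff.mp isOpen_minorizedCore 0 h
  have hne : ∀ i, (convPow d μ i).support.Nonempty := fun i =>
    Measure.nonempty_support (IsProbabilityMeasure.ne_zero _)
  choose y hy using hne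
  set K := ∑ i ∈ Finset.range n, ‖y i‖
  have hK0 : 0 ≤ K := Finset.sum_nonneg fun i _ => norm_nonneg _
  have hK : ∀ i < n, ‖y i‖ ≤ K := fun i hi =>
    Finset.single_le_sum (f := fun i => ‖y i‖) (fun i _ => norm_nonneg _)
      (Finset.mem_range.mpr hi)
  have hn' : (0 : ℝ) < n := by exact_mod_cast hn
  refine ⟨r / n, by positivity, -r - K - 1, fun m w hw => ?_⟩
  rw [mem_closedBall_zero_iff] at hw
  have hi := Nat.mod_lt m hn
  have hm := Nat.div_add_mod m n
  have hdiv : r / n * m < (m / n : ℕ) * r + r := by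
    have h1 : (m : ℝ) < n * (m / n : ℕ) + n := by
      have : m < n * (m / n) + n := by omega
      exact_mod_cast this
    rw [div_mul_eq_mul_div, div_lt_iff₀ hn']
    nlinarith
  have hlt : ‖w - y (m % n)‖ < (m / n : ℕ) * r := by
    linarith [norm_sub_le w (y (m % n)), hK _ hi]
  obtain ⟨j, hj⟩ : ∃ j, m / n = j + 1 := by
    refine Nat.exists_eq_succ_of_ne_zero fun h0 => ?_
    rw [h0, Nat.cast_zero, zero_mul] at hlt
    exact (norm_nonneg _).not_gt hlt
  rw [hj] at hlt hm
  have hmem := ball_subset_minorizedCore_convPow_mul hball j (mem_ball_zero_iff.mpr hlt)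
  have hadd := add_mem_minorizedCore_conv hmem (hy (m % n))
  rwa [← convPow_add, sub_add_cancel, hm] at hadd

lemma support_subset_suppSpan : Γ.support ⊆ suppSpan d Γ := by
  intro x hx
  exact Submodule.subset_span fun U hU hxU =>
    (Measure.mem_support_iff_forall x).mp hx U (hU.mem_nhds hxU)

lemma support_convPow_subset_suppSpan [IsProbabilityMeasure Γ] (hρ : ρ ∈ Ioo (0 : ℝ) 1)
    (n : ℕ) : (convPow d (mixMeasure d ρ Γ) n).support ⊆ suppSpan d Γ := by
  have := isProbabilityMeasure_mixMeasure (Γ := Γ) hρ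
  induction n with
  | zero =>
    intro z hz
    rw [eq_zero_of_mem_support_convPow_zero hz]
    exact zero_mem _
  | succ n ih =>
    intro z hz
    have hclosed : IsClosed (suppSpan d Γ : Set (Ed d)) :=
      Submodule.closed_of_finiteDimensional _
    rw [← hclosed.closure_eq, Metric.mem_closure_iff]
    intro ε hε
    obtain ⟨x, hx, y, hy, hxy⟩ := exists_add_mem_of_mem_support_conv hz hε
    refine ⟨x + y, add_mem (ih hx) ?_, by rwa [dist_eq_norm]⟩
    obtain ⟨u, hu, rfl | rfl⟩ := (mem_support_mixMeasure_iff hρ).mp hy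
    · exact Submodule.smul_mem _ _ (support_subset_suppSpan hu)
    · exact Submodule.smul_mem _ _ (support_subset_suppSpan hu)

lemma suppSpan_eq_top [IsProbabilityMeasure Γ] (hρ : ρ ∈ Ioo (0 : ℝ) 1)
    (h : SpreadOut d (mixMeasure d ρ Γ)) : suppSpan d Γ = ⊤ := by
  have := isProbabilityMeasure_mixMeasure (Γ := Γ) hρ
  obtain ⟨n, -, hne⟩ := h.exists_nonempty_minorizedCore
  refine Submodule.eq_top_of_nonempty_interior' _ (hne.mono ?_)
  exact interior_maximal
    (minorizedCore_subset_support.trans (support_convPow_subset_suppSpan hρ n))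
    isOpen_minorizedCore

end Convolution

section Kernel

variable {d : ℕ} {ρ ι : ℝ} {Γ : Measure (Ed d)} {g : Ed d → Ed d → ℝ} {h : Ed d → ℝ}

lemma integrable_of_mem_Icc {α : Type*} [MeasurableSpace α] {μ : Measure α} [IsFiniteMeasure μ]
    {f : α → ℝ} (hf : Measurable f) (h01 : ∀ x, f x ∈ Icc (0 : ℝ) 1) : Integrable f μ :=
  Integrable.of_bound hf.aestronglyMeasurable 1
    (ae_of_all _ fun x => by rw [Real.norm_of_nonneg (h01 x).1]; exact (h01 x).2)

lemma integral_mem_Icc {α : Type*} [MeasurableSpace α] {μ : Measure α} [IsProbabilityMeasure μ]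
    {f : α → ℝ} (hf : Measurable f) (h01 : ∀ x, f x ∈ Icc (0 : ℝ) 1) :
    ∫ x, f x ∂μ ∈ Icc (0 : ℝ) 1 := by
  refine ⟨integral_nonneg fun x => (h01 x).1, ?_⟩
  simpa using integral_mono (μ := μ) (integrable_of_mem_Icc hf h01) (integrable_const (1 : ℝ))
    fun x => (h01 x).2

lemma integral_convPow_succ {μ : Measure (Ed d)} [IsProbabilityMeasure μ] (n : ℕ)
    (hh : Measurable h) (h01 : ∀ x, h x ∈ Icc (0 : ℝ) 1) (Λ : Ed d) :
    ∫ w, h (Λ + w) ∂convPow d μ (n + 1) =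
      ∫ x, ∫ y, h (Λ + x + y) ∂μ ∂convPow d μ n := by
  have hmeas : Measurable fun p : Ed d × Ed d => p.1 + p.2 := by fun_prop
  have hhΛ : Measurable fun w => h (Λ + w) := hh.comp (measurable_const_add Λ)
  have hint : Integrable (fun p : Ed d × Ed d => h (Λ + (p.1 + p.2))) ((convPow d μ n).prod μ) :=
    integrable_of_mem_Icc (hhΛ.comp hmeas) fun p => h01 _
  rw [convPow_succ, Measure.conv, integral_map hmeas.aemeasurable hhΛ.aestronglyMeasurable,
    integral_prod _ hint]
  simp only [add_assoc]

lemma integral_mixMeasure [IsProbabilityMeasure Γ] (hρ : ρ ∈ Ioo (0 : ℝ) 1) (hh : Measurable h)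
    (h01 : ∀ x, h x ∈ Icc (0 : ℝ) 1) :
    ∫ x, h x ∂mixMeasure d ρ Γ =
      ρ * ∫ X, h ((1 - ρ) • X) ∂Γ + (1 - ρ) * ∫ X, h ((-ρ) • X) ∂Γ := by
  have h1 : AEMeasurable (fun x : Ed d => (1 - ρ) • x) Γ := by fun_prop
  have h2 : AEMeasurable (fun x : Ed d => (-ρ) • x) Γ := by fun_prop
  rw [mixMeasure, integral_add_measure
      ((integrable_of_mem_Icc hh h01).smul_measure ENNReal.ofReal_ne_top)
      ((integrable_of_mem_Icc hh h01).smul_measure ENNReal.ofReal_ne_top),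
    integral_smul_measure, integral_smul_measure, integral_map h1 hh.aestronglyMeasurable,
    integral_map h2 hh.aestronglyMeasurable, ENNReal.toReal_ofReal hρ.1.le,
    ENNReal.toReal_ofReal (sub_nonneg.mpr hρ.2.le), smul_eq_mul, smul_eq_mul]

lemma kernelOp_integrand_mem_Icc (hg01 : ∀ Λ X, g Λ X ∈ Icc (0 : ℝ) 1)
    (h01 : ∀ x, h x ∈ Icc (0 : ℝ) 1) (Λ X : Ed d) :
    g Λ X * h (Λ + (1 - ρ) • X) + (1 - g Λ X) * h (Λ - ρ • X) ∈ Icc (0 : ℝ) 1 := by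
  obtain ⟨hg0, hg1⟩ := hg01 Λ X
  exact (convex_Icc (0 : ℝ) 1) (h01 _) (h01 _) hg0 (sub_nonneg.mpr hg1) (by ring)

lemma measurable_kernelOp_integrand (hg : Measurable (Function.uncurry g)) (hh : Measurable h) :
    Measurable fun p : Ed d × Ed d =>
      g p.1 p.2 * h (p.1 + (1 - ρ) • p.2) + (1 - g p.1 p.2) * h (p.1 - ρ • p.2) := by
  have hg' : Measurable fun p : Ed d × Ed d => g p.1 p.2 := hg
  exact (hg'.mul (hh.comp (by fun_prop))).add
    ((measurable_const.sub hg').mul (hh.comp (by fun_prop)))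

lemma measurable_kernelOp [IsProbabilityMeasure Γ] (hg : Measurable (Function.uncurry g))
    (hh : Measurable h) : Measurable (kernelOp d ρ Γ g h) :=
  (StronglyMeasurable.integral_prod_right'
    (measurable_kernelOp_integrand hg hh).stronglyMeasurable).measurable

lemma kernelOp_mem_Icc [IsProbabilityMeasure Γ] (hg : Measurable (Function.uncurry g))
    (hg01 : ∀ Λ X, g Λ X ∈ Icc (0 : ℝ) 1) (hh : Measurable h)
    (h01 : ∀ x, h x ∈ Icc (0 : ℝ) 1) (Λ : Ed d) : kernelOp d ρ Γ g h Λ ∈ Icc (0 : ℝ) 1 :=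
  integral_mem_Icc ((measurable_kernelOp_integrand hg hh).comp measurable_prodMk_left)
    (kernelOp_integrand_mem_Icc hg01 h01 Λ)

lemma mul_integral_mixMeasure_le_kernelOp [IsProbabilityMeasure Γ] (hρ : ρ ∈ Ioo (0 : ℝ) 1)
    (hι : 0 ≤ ι) (hg : Measurable (Function.uncurry g))
    (hgι : ∀ Λ X, g Λ X ∈ Icc ι (1 - ι)) (hh : Measurable h)
    (h01 : ∀ x, h x ∈ Icc (0 : ℝ) 1) (Λ : Ed d) :
    ι * ∫ x, h (Λ + x) ∂mixMeasure d ρ Γ ≤ kernelOp d ρ Γ g h Λ := by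
  have hg01 : ∀ Λ X, g Λ X ∈ Icc (0 : ℝ) 1 := fun Λ X =>
    ⟨hι.trans (hgι Λ X).1, (hgι Λ X).2.trans (by linarith)⟩
  have hhΛ : Measurable fun w => h (Λ + w) := hh.comp (measurable_const_add Λ)
  have hi1 : Integrable (fun X => h (Λ + (1 - ρ) • X)) Γ :=
    integrable_of_mem_Icc (hhΛ.comp (measurable_const_smul _)) fun _ => h01 _
  have hi2 : Integrable (fun X => h (Λ + (-ρ) • X)) Γ :=
    integrable_of_mem_Icc (hhΛ.comp (measurable_const_smul _)) fun _ => h01 _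
  rw [integral_mixMeasure hρ hhΛ fun _ => h01 _, ← integral_const_mul, ← integral_const_mul,
    ← integral_add (hi1.const_mul _) (hi2.const_mul _), ← integral_const_mul]
  refine integral_mono (((hi1.const_mul _).add (hi2.const_mul _)).const_mul _)
    (integrable_of_mem_Icc ((measurable_kernelOp_integrand hg hh).comp measurable_prodMk_left)
      (kernelOp_integrand_mem_Icc hg01 h01 Λ)) fun X => ?_
  simp only [neg_smul, ← sub_eq_add_neg]
  have hc1 : ι * ρ ≤ g Λ X := by nlinarith [hρ.2, (hgι Λ X).1]
  have hc2 : ι * (1 - ρ) ≤ 1 - g Λ X := by nlinarith [hρ.1, (hgι Λ X).2]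
  nlinarith [mul_le_mul_of_nonneg_right hc1 (h01 (Λ + (1 - ρ) • X)).1,
    mul_le_mul_of_nonneg_right hc2 (h01 (Λ - ρ • X)).1]

lemma pow_mul_integral_convPow_le_iterate_kernelOp [IsProbabilityMeasure Γ]
    (hρ : ρ ∈ Ioo (0 : ℝ) 1) (hι : 0 ≤ ι) (hg : Measurable (Function.uncurry g))
    (hgι : ∀ Λ X, g Λ X ∈ Icc ι (1 - ι)) (m : ℕ) (Λ : Ed d) :
    ∀ h : Ed d → ℝ, Measurable h → (∀ x, h x ∈ Icc (0 : ℝ) 1) →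
      ι ^ m * ∫ w, h (Λ + w) ∂convPow d (mixMeasure d ρ Γ) m ≤ (kernelOp d ρ Γ g)^[m] h Λ := by
  have := isProbabilityMeasure_mixMeasure (Γ := Γ) hρ
  have hg01 : ∀ Λ X, g Λ X ∈ Icc (0 : ℝ) 1 := fun Λ X =>
    ⟨hι.trans (hgι Λ X).1, (hgι Λ X).2.trans (by linarith)⟩
  induction m with
  | zero =>
    intro h hh h01
    change ι ^ 0 * ∫ w, h (Λ + w) ∂Measure.dirac 0 ≤ h Λ
    simp
  | succ m ih =>
    intro h hh h01
    have hk01 := kernelOp_mem_Icc (ρ := ρ) (Γ := Γ) hg hg01 hh h01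
    have hkm := measurable_kernelOp (ρ := ρ) (Γ := Γ) hg hh
    have hhm : Measurable fun p : Ed d × Ed d => h (Λ + p.1 + p.2) := hh.comp (by fun_prop)
    rw [Function.iterate_succ_apply]
    refine le_trans ?_ (ih _ hkm hk01)
    rw [integral_convPow_succ m hh h01, pow_succ, mul_assoc, ← integral_const_mul]
    refine mul_le_mul_of_nonneg_left (integral_mono ?_ ?_ fun x => ?_) (pow_nonneg hι m)
    · refine (integrable_of_mem_Icc ?_ fun x => integral_mem_Icc ?_ fun y => h01 _).const_mul _
      · exact (StronglyMeasurable.integral_prod_right' hhm.stronglyMeasurable).measurable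
      · exact hhm.comp measurable_prodMk_left
    · exact integrable_of_mem_Icc (hkm.comp (measurable_const_add Λ)) fun x => hk01 _
    · exact mul_integral_mixMeasure_le_kernelOp hρ hι hg hgι hh h01 (Λ + x)

end Kernel

/-- Small-set lower bound for the `m`-step CAR kernel, uniform over allocation functions with
values in `[ι, 1−ι]`, when `Γ_ρ` is spread out; consequently `W_Γ = ℝ^d`. -/
theorem stmt5 (d : ℕ) (ρ ι : ℝ) (hρ : ρ ∈ Set.Ioo (0 : ℝ) 1)
    (hι : ι ∈ Set.Ioo (0 : ℝ) (1 / 2))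
    (Γ : Measure (Ed d)) [IsProbabilityMeasure Γ]
    (hso : SpreadOut d (mixMeasure d ρ Γ)) :
    (∃ dmin : ℕ, 0 < dmin ∧ ∃ a > (0 : ℝ), ∃ b : ℝ,
      ∀ m : ℕ, dmin ≤ m → ∃ δ > (0 : ℝ),
        ∀ g : Ed d → Ed d → ℝ, Measurable (Function.uncurry g) →
          (∀ Λ X, g Λ X ∈ Set.Icc ι (1 - ι)) →
          ∀ (Λ : Ed d) (A : Set (Ed d)), MeasurableSet A →
            δ * (volume (A ∩ Metric.ball Λ (a * m + b))).toReal
              ≤ (kernelOp d ρ Γ g)^[m] (A.indicator fun _ => (1 : ℝ)) Λ) ∧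
    suppSpan d Γ = ⊤ := by
  have := isProbabilityMeasure_mixMeasure (Γ := Γ) hρ
  refine ⟨?_, suppSpan_eq_top hρ hso⟩
  obtain ⟨n, hn, h0⟩ := exists_zero_mem_minorizedCore hρ hso
  obtain ⟨a, ha, b, hab⟩ := exists_closedBall_subset_minorizedCore_convPow hn h0
  refine ⟨1, one_pos, a, ha, b, fun m _ => ?_⟩
  obtain ⟨η, hη, hmin⟩ := (minorizedOn_of_isCompact (isCompact_closedBall _ _) (hab m)).mono
    Metric.ball_subset_closedBall
  refine ⟨ι ^ m * η, mul_pos (pow_pos hι.1 m) hη, fun g hg hgι Λ A hA => ?_⟩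
  have hAΛ : MeasurableSet ((fun w => Λ + w) ⁻¹' A) := measurable_const_add Λ hA
  have hvol : volume (A ∩ Metric.ball Λ (a * m + b)) =
      volume ((fun w => Λ + w) ⁻¹' A ∩ Metric.ball 0 (a * m + b)) := by
    rw [← measure_preimage_add volume Λ (A ∩ _), preimage_inter, preimage_add_ball, sub_self]
  refine le_trans ?_ (pow_mul_integral_convPow_le_iterate_kernelOp hρ hι.1.le hg hgι m Λ _
    (measurable_const.indicator hA) fun x => ?_)
  · rw [mul_assoc, hvol]
    refine mul_le_mul_of_nonneg_left ?_ (pow_nonneg hι.1.le m)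
    change _ ≤ ∫ w, ((fun w => Λ + w) ⁻¹' A).indicator (fun _ => (1 : ℝ)) w ∂_
    rw [integral_indicator_const _ hAΛ, smul_eq_mul, mul_one, Measure.real]
    have hle := ENNReal.toReal_mono (measure_ne_top _ _) (hmin _ hAΛ)
    rwa [ENNReal.toReal_mul, ENNReal.coe_toReal] at hle
  · by_cases hx : x ∈ A <;> simp [hx]
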